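/- Let k ∈ ℤ with k > 0 and let f : ℍ → ℂ be smooth with Δ_k f = 0. Then R_{−k}(L_k^{k} f) = 0. -/

import Mathlib

open Complex

noncomputable section

/-- The upper half-plane, as a subset of `ℂ`. -/
def UH : Set ℂ := {z : ℂ | 0 < z.im}

/-- Partial derivative in the direction of the real axis, `∂f/∂u`. -/
noncomputable def du (f : ℂ → ℂ) (z : ℂ) : ℂ := fderiv ℝ f z 1

/-- Partial derivative in the direction of the imaginary axis, `∂f/∂v`. -/
noncomputable def dv (f : ℂ → ℂ) (z : ℂ) : ℂ := fderiv ℝ f z Complex.I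

/-- The Wirtinger derivative `∂_τ f = (1/2)(∂f/∂u − i ∂f/∂v)`. -/
noncomputable def dtau (f : ℂ → ℂ) (z : ℂ) : ℂ :=
  (1 / 2) * (du f z - Complex.I * dv f z)

/-- The Wirtinger derivative `∂_τ̄ f = (1/2)(∂f/∂u + i ∂f/∂v)`. -/
noncomputable def dtauBar (f : ℂ → ℂ) (z : ℂ) : ℂ :=
  (1 / 2) * (du f z + Complex.I * dv f z)

/-- The Maass raising operator `R_k f = 2i ∂_τ f + (k/v) f`. -/
noncomputable def Rop (k : ℤ) (f : ℂ → ℂ) (z : ℂ) : ℂ :=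
  2 * Complex.I * dtau f z + ((k : ℂ) / (z.im : ℂ)) * f z

/-- The Maass lowering operator `L_k f = −2i v² ∂_τ̄ f`. -/
noncomputable def Lop (_k : ℤ) (f : ℂ → ℂ) (z : ℂ) : ℂ :=
  -2 * Complex.I * (z.im : ℂ) ^ 2 * dtauBar f z

/-- The weight-`k` hyperbolic Laplacian
`Δ_k f = −v²(∂²f/∂u² + ∂²f/∂v²) + i k v (∂f/∂u + i ∂f/∂v)`. -/
noncomputable def Lap (k : ℤ) (f : ℂ → ℂ) (z : ℂ) : ℂ :=
  -(z.im : ℂ) ^ 2 * (du (du f) z + dv (dv f) z)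
    + Complex.I * (k : ℂ) * (z.im : ℂ) * (du f z + Complex.I * dv f z)

/-- Iterated raising operator `R_k^r = R_{k+2(r−1)} ∘ ⋯ ∘ R_{k+2} ∘ R_k`, `R_k^0 = id`. -/
noncomputable def Riter (k : ℤ) : ℕ → (ℂ → ℂ) → ℂ → ℂ
  | 0, f => f
  | r + 1, f => Rop (k + 2 * (r : ℤ)) (Riter k r f)

/-- Iterated lowering operator `L_k^r = L_{k−2(r−1)} ∘ ⋯ ∘ L_{k−2} ∘ L_k`, `L_k^0 = id`. -/
noncomputable def Liter (k : ℤ) : ℕ → (ℂ → ℂ) → ℂ → ℂ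
  | 0, f => f
  | r + 1, f => Lop (k - 2 * (r : ℤ)) (Liter k r f)

theorem isOpen_UH : IsOpen UH := isOpen_lt continuous_const Complex.continuous_im

theorem ContDiffOn.fderiv_apply_UH {f : ℂ → ℂ} (hf : ContDiffOn ℝ (⊤ : ℕ∞) f UH) (w : ℂ) :
    ContDiffOn ℝ (⊤ : ℕ∞) (fun z => fderiv ℝ f z w) UH :=
  (hf.fderiv_of_isOpen isOpen_UH (m := (⊤ : ℕ∞)) le_rfl).clm_apply contDiffOn_const

theorem ContDiffOn.differentiableAt_UH {f : ℂ → ℂ} (hf : ContDiffOn ℝ (⊤ : ℕ∞) f UH) {z : ℂ}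
    (hz : z ∈ UH) : DifferentiableAt ℝ f z :=
  (hf.contDiffAt (isOpen_UH.mem_nhds hz)).differentiableAt (by simp)

theorem dv_du_eq_du_dv {f : ℂ → ℂ} (hf : ContDiffOn ℝ (⊤ : ℕ∞) f UH) {z : ℂ} (hz : z ∈ UH) :
    fderiv ℝ (du f) z I = fderiv ℝ (dv f) z 1 := by
  have hd : DifferentiableAt ℝ (fderiv ℝ f) z :=
    ((hf.fderiv_of_isOpen isOpen_UH (m := (⊤ : ℕ∞)) le_rfl).contDiffAt
      (isOpen_UH.mem_nhds hz)).differentiableAt (by simp)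
  have hsymm : IsSymmSndFDerivAt ℝ f z :=
    (hf.contDiffAt (isOpen_UH.mem_nhds hz)).isSymmSndFDerivAt
      (by simp only [minSmoothness_of_isRCLikeNormedField]; exact WithTop.coe_le_coe.2 (le_top (a := (2 : ℕ∞))))
  have happly (a b : ℂ) : fderiv ℝ (fun y => fderiv ℝ f y a) z b = fderiv ℝ (fderiv ℝ f) z b a := by
    rw [fderiv_clm_apply hd (differentiableAt_const a)]
    simp
  exact (happly 1 I).trans ((hsymm.eq I 1).trans (happly I 1).symm)

theorem hasFDerivAt_ofReal_im (z : ℂ) :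
    HasFDerivAt (fun z : ℂ => (z.im : ℂ)) (ofRealCLM.comp imCLM) z :=
  (ofRealCLM.comp imCLM).hasFDerivAt

theorem contDiff_ofReal_im : ContDiff ℝ (⊤ : ℕ∞) (fun z : ℂ => (z.im : ℂ)) :=
  (ofRealCLM.comp imCLM).contDiff

theorem ofReal_im_ne_zero {z : ℂ} (hz : z ∈ UH) : (z.im : ℂ) ≠ 0 :=
  ofReal_ne_zero.2 (ne_of_gt hz)

theorem contDiffOn_Lop {f : ℂ → ℂ} (hf : ContDiffOn ℝ (⊤ : ℕ∞) f UH) (k : ℤ) :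
    ContDiffOn ℝ (⊤ : ℕ∞) (Lop k f) UH :=
  (contDiffOn_const.mul (contDiff_ofReal_im.contDiffOn.pow 2)).mul
    (contDiffOn_const.mul ((hf.fderiv_apply_UH 1).add (contDiffOn_const.mul (hf.fderiv_apply_UH I))))

theorem contDiffOn_Liter {f : ℂ → ℂ} (hf : ContDiffOn ℝ (⊤ : ℕ∞) f UH) (k : ℤ) (r : ℕ) :
    ContDiffOn ℝ (⊤ : ℕ∞) (Liter k r f) UH := by
  induction r with
  | zero => exact hf
  | succ r ih => exact contDiffOn_Lop ih _

theorem fderiv_Lop_apply {f : ℂ → ℂ} (hf : ContDiffOn ℝ (⊤ : ℕ∞) f UH) (k : ℤ) {z : ℂ}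
    (hz : z ∈ UH) (w : ℂ) :
    fderiv ℝ (Lop k f) z w = -I * (2 * z.im * w.im * (du f z + I * dv f z) +
      (z.im : ℂ) ^ 2 * (fderiv ℝ (du f) z w + I * fderiv ℝ (dv f) z w)) := by
  have hu : HasFDerivAt (du f) (fderiv ℝ (du f) z) z :=
    ((hf.fderiv_apply_UH 1).differentiableAt_UH hz).hasFDerivAt
  have hv : HasFDerivAt (dv f) (fderiv ℝ (dv f) z) z :=
    ((hf.fderiv_apply_UH I).differentiableAt_UH hz).hasFDerivAt
  have h : HasFDerivAt (Lop k f) _ z :=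
    (((hasFDerivAt_ofReal_im z).pow 2).const_mul (-2 * I)).mul
      ((hu.add (hv.const_mul I)).const_mul (1 / 2))
  rw [h.fderiv]
  simp [dtauBar]
  ring

theorem fderiv_Rop_apply {f : ℂ → ℂ} (hf : ContDiffOn ℝ (⊤ : ℕ∞) f UH) (k : ℤ) {z : ℂ}
    (hz : z ∈ UH) (w : ℂ) :
    fderiv ℝ (Rop k f) z w = I * (fderiv ℝ (du f) z w - I * fderiv ℝ (dv f) z w) +
      k / z.im * fderiv ℝ f z w - k * w.im / (z.im : ℂ) ^ 2 * f z := by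
  have hu : HasFDerivAt (du f) (fderiv ℝ (du f) z) z :=
    ((hf.fderiv_apply_UH 1).differentiableAt_UH hz).hasFDerivAt
  have hv : HasFDerivAt (dv f) (fderiv ℝ (dv f) z) z :=
    ((hf.fderiv_apply_UH I).differentiableAt_UH hz).hasFDerivAt
  have hinv : HasFDerivAt (fun z : ℂ => ((z.im : ℂ))⁻¹) _ z :=
    (hasDerivAt_inv (ofReal_im_ne_zero hz)).comp_hasFDerivAt z (hasFDerivAt_ofReal_im z)
  have h : HasFDerivAt (Rop k f) _ z :=
    (((hu.sub (hv.const_mul I)).const_mul (1 / 2)).const_mul (2 * I)).add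
      ((hinv.const_mul (k : ℂ)).mul (hf.differentiableAt_UH hz).hasFDerivAt)
  rw [h.fderiv]
  simp
  ring

theorem Rop_Lop_eq_neg_Lap {f : ℂ → ℂ} (hf : ContDiffOn ℝ (⊤ : ℕ∞) f UH) (k l : ℤ) {z : ℂ}
    (hz : z ∈ UH) : Rop (k - 2) (Lop l f) z = -Lap k f z := by
  have hne := ofReal_im_ne_zero hz
  rw [Rop, dtau, du, dv, fderiv_Lop_apply hf l hz, fderiv_Lop_apply hf l hz,
    dv_du_eq_du_dv hf hz, Lap, Lop, dtauBar, du.eq_def (du f), dv.eq_def (dv f)]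
  simp only [one_im, I_im, ofReal_zero, ofReal_one, Int.cast_sub, Int.cast_ofNat]
  field_simp
  ring_nf
  simp only [I_sq, I_pow_three, I_pow_four]
  ring

theorem Lop_Rop_eq_neg_Lap_sub {f : ℂ → ℂ} (hf : ContDiffOn ℝ (⊤ : ℕ∞) f UH) (k l : ℤ) {z : ℂ}
    (hz : z ∈ UH) : Lop l (Rop k f) z = -Lap k f z - k * f z := by
  have hne := ofReal_im_ne_zero hz
  rw [Lop, dtauBar, du, dv, fderiv_Rop_apply hf k hz, fderiv_Rop_apply hf k hz,
    dv_du_eq_du_dv hf hz, Lap, du.eq_def (du f), dv.eq_def (dv f), du, dv]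
  simp only [one_im, I_im, ofReal_zero, ofReal_one]
  field_simp
  ring_nf
  simp only [I_sq, I_pow_four]
  ring

theorem Lop_eq_const_mul_of_eqOn {f g : ℂ → ℂ} (hg : ContDiffOn ℝ (⊤ : ℕ∞) g UH) (c : ℂ) (k l : ℤ)
    (h : ∀ z ∈ UH, f z = c * g z) {z : ℂ} (hz : z ∈ UH) : Lop k f z = c * Lop l g z := by
  have hfg : f =ᶠ[nhds z] fun z => c * g z :=
    Filter.eventually_of_mem (isOpen_UH.mem_nhds hz) h
  have hd : fderiv ℝ f z = c • fderiv ℝ g z := by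
    rw [hfg.fderiv_eq, fderiv_const_mul (hg.differentiableAt_UH hz)]
  simp only [Lop, dtauBar, du, dv, hd, smul_apply, smul_eq_mul]
  ring

/-- Raising an iterated lowering of a harmonic function undoes one lowering, up to a scalar. -/
theorem Rop_Liter_succ_of_Lap_eq_zero {k : ℤ} {f : ℂ → ℂ} (hf : ContDiffOn ℝ (⊤ : ℕ∞) f UH)
    (hharm : ∀ z ∈ UH, Lap k f z = 0) (j : ℕ) :
    ∀ z ∈ UH, Rop (k - 2 * j - 2) (Liter k (j + 1) f) z =
      (j * (k - 1 - j) : ℂ) * Liter k j f z := by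
  induction j with
  | zero =>
    intro z hz
    simpa [Liter, hharm z hz] using Rop_Lop_eq_neg_Lap hf k k hz
  | succ j ih =>
    intro z hz
    have hs := contDiffOn_Liter hf k (j + 1)
    have hcomm := Lop_Rop_eq_neg_Lap_sub hs (k - 2 * j - 2) (k - 2 * j) hz
    rw [Lop_eq_const_mul_of_eqOn (contDiffOn_Liter hf k j) _ _ (k - 2 * j) ih hz] at hcomm
    have hRL := Rop_Lop_eq_neg_Lap hs (k - 2 * j - 2) (k - 2 * ((j + 1 : ℕ) : ℤ)) hz
    rw [show k - 2 * ((j + 1 : ℕ) : ℤ) - 2 = k - 2 * j - 2 - 2 by push_cast; ring, Liter, hRL]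
    rw [Liter] at hcomm ⊢
    push_cast at hcomm ⊢
    linear_combination -hcomm

/-- if `k > 0` and `Δ_k f = 0` then `R_{−k}(L_k^k f) = 0`. -/
theorem stmt4 (k : ℤ) (hk : 0 < k) (f : ℂ → ℂ) (hf : ContDiffOn ℝ (⊤ : ℕ∞) f UH)
    (hharm : ∀ z ∈ UH, Lap k f z = 0) :
    ∀ z ∈ UH, Rop (-k) (Liter k k.toNat f) z = 0 := by
  obtain ⟨n, rfl⟩ : ∃ n : ℕ, k = n + 1 := ⟨(k - 1).toNat, by omega⟩
  intro z hz
  have h := Rop_Liter_succ_of_Lap_eq_zero hf hharm n z hz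
  rw [show ((n : ℤ) + 1 - 2 * n - 2) = -(n + 1) by ring] at h
  rw [show ((n : ℤ) + 1).toNat = n + 1 by omega, h]
  push_cast
  ring
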